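/- Let m, t, n_1, …, n_t, k_1, …, k_m be nonnegative integers with k_1 + ⋯ + k_m = n_1 + ⋯ + n_t. Then [n_1 + ⋯ + n_t; k_1, …, k_m]_q = Σ q^{Σ_{u=1}^{t} Σ_{v=2}^{m} f(r_{u,v})} · [n_1; r_{1,1}, …, r_{1,m}]_q ⋯ [n_t; r_{t,1}, …, r_{t,m}]_q, where the sum is over all t × m arrays of nonnegative integers (r_{u,v}) satisfying r_{u,1} + ⋯ + r_{u,m} = n_u for every u ∈ {1,…,t} and r_{1,v} + ⋯ + r_{t,v} = k_v for every v ∈ {1,…,m}, and where f(r_{u,v}) = r_{u,v} · Σ_{i=u+1}^{t} Σ_{j=1}^{v−1} r_{i,j}. -/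

import Mathlib

open Finset Polynomial

/-- Number of inversions of a sequence. -/
def invStat {n m : ℕ} (σ : Fin n → Fin m) : ℕ :=
  ((Finset.univ : Finset (Fin n × Fin n)).filter fun p => p.1 < p.2 ∧ σ p.2 < σ p.1).card

/-- The `q`-multinomial coefficient `[n; k_1, …, k_m]_q`, defined as the generating
polynomial `Σ_σ q^{inv σ}` over the set `S(n, m; k_1, …, k_m)` of sequences of length `n`
with entries in `{1, …, m}` (encoded as `Fin m`) having exactly `k_j` entries equal to
`j` for each `j`. -/
noncomputable def qMultinomial (n m : ℕ) (k : Fin m → ℕ) : Polynomial ℤ :=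
  ∑ σ ∈ (Finset.univ : Finset (Fin n → Fin m)).filter
      (fun σ => ∀ j, (Finset.univ.filter fun a => σ a = j).card = k j),
    X ^ invStat σ

theorem finSigmaFinEquiv_lt_of_fst_lt {t : ℕ} {n : Fin t → ℕ} {u i : Fin t} (h : u < i)
    (a : Fin (n u)) (b : Fin (n i)) :
    (finSigmaFinEquiv ⟨u, a⟩ : Fin (∑ u, n u)) < finSigmaFinEquiv ⟨i, b⟩ := by
  rw [Fin.lt_def, finSigmaFinEquiv_apply, finSigmaFinEquiv_apply]
  have key : ∑ x : Fin (u : ℕ), n (Fin.castLE u.2.le x) + n u ≤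
      ∑ x : Fin (i : ℕ), n (Fin.castLE i.2.le x) := by
    have h1 : ∑ x : Fin (u : ℕ), n (Fin.castLE u.2.le x) + n u =
        ∑ x : Fin ((u : ℕ) + 1), n (Fin.castLE u.2 x) := by
      rw [Fin.sum_univ_castSucc]
      rfl
    have h2 : (u : ℕ) + 1 ≤ i := h
    rw [h1]
    calc ∑ x : Fin ((u : ℕ) + 1), n (Fin.castLE u.2 x)
        = ∑ x ∈ Finset.univ.map (Fin.castLEEmb h2), n (Fin.castLE i.2.le x) := by
          rw [Finset.sum_map]
          rfl
      _ ≤ ∑ x : Fin (i : ℕ), n (Fin.castLE i.2.le x) :=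
          Finset.sum_le_univ_sum_of_nonneg fun _ => Nat.zero_le _
  have := a.2
  dsimp only
  omega

theorem finSigmaFinEquiv_lt_iff_of_fst_eq {t : ℕ} {n : Fin t → ℕ} (u : Fin t)
    (a b : Fin (n u)) :
    (finSigmaFinEquiv ⟨u, a⟩ : Fin (∑ u, n u)) < finSigmaFinEquiv ⟨u, b⟩ ↔ a < b := by
  rw [Fin.lt_def, finSigmaFinEquiv_apply, finSigmaFinEquiv_apply]
  simp

/-- The number of entries of `σ` equal to `j`. -/
def letterCount {n m : ℕ} (σ : Fin n → Fin m) (j : Fin m) : ℕ :=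
  (Finset.univ.filter fun a => σ a = j).card

theorem letterCount_le {n m : ℕ} (σ : Fin n → Fin m) (j : Fin m) : letterCount σ j ≤ n := by
  simpa [letterCount] using Finset.card_le_univ (Finset.univ.filter fun a => σ a = j)

theorem sum_letterCount {n m : ℕ} (σ : Fin n → Fin m) : ∑ j, letterCount σ j = n := by
  simpa [letterCount] using
    (Finset.card_eq_sum_card_fiberwise (f := σ) (s := univ) (t := univ) (by simp)).symm

theorem sum_comp_eq_sum_letterCount_mul {n m : ℕ} (σ : Fin n → Fin m) (F : Fin m → ℕ) :
    ∑ a, F (σ a) = ∑ v, letterCount σ v * F v := by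
  simp_rw [letterCount, Finset.card_filter, Finset.sum_mul]
  rw [Finset.sum_comm]
  simp

theorem card_cross_inversions {n n' m : ℕ} (σ : Fin n → Fin m) (τ : Fin n' → Fin m) :
    ∑ a, ∑ b, (if τ b < σ a then 1 else 0) =
      ∑ v, letterCount σ v * ∑ j ∈ Finset.univ.filter (fun j => j < v), letterCount τ j := by
  rw [← sum_comp_eq_sum_letterCount_mul σ
    fun v => ∑ j ∈ Finset.univ.filter (fun j => j < v), letterCount τ j]
  refine Finset.sum_congr rfl fun a _ => ?_
  rw [sum_comp_eq_sum_letterCount_mul τ fun j => if j < σ a then 1 else 0, Finset.sum_filter]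
  simp

theorem invStat_eq_sum {n m : ℕ} (σ : Fin n → Fin m) :
    invStat σ = ∑ a, ∑ b, if a < b ∧ σ b < σ a then 1 else 0 := by
  rw [invStat, Finset.card_filter, Fintype.sum_prod_type]

/-- Cutting a sequence of length `∑ u, n u` into consecutive blocks of lengths `n u`. -/
def blockEquiv (m t : ℕ) (n : Fin t → ℕ) :
    (Fin (∑ u, n u) → Fin m) ≃ (∀ u, Fin (n u) → Fin m) :=
  (finSigmaFinEquiv.symm.arrowCongr (Equiv.refl _)).trans
    (Equiv.piCurry fun u (_ : Fin (n u)) => Fin m)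

theorem blockEquiv_apply {m t : ℕ} {n : Fin t → ℕ} (σ : Fin (∑ u, n u) → Fin m) (u : Fin t)
    (a : Fin (n u)) : blockEquiv m t n σ u a = σ (finSigmaFinEquiv ⟨u, a⟩) := rfl

theorem letterCount_eq_sum_blocks {m t : ℕ} {n : Fin t → ℕ} (σ : Fin (∑ u, n u) → Fin m)
    (j : Fin m) : letterCount σ j = ∑ u, letterCount (blockEquiv m t n σ u) j := by
  simp_rw [letterCount, Finset.card_filter, blockEquiv_apply]
  rw [← Equiv.sum_comp finSigmaFinEquiv, Fintype.sum_sigma]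
  rfl

theorem invStat_eq_sum_blocks {m t : ℕ} {n : Fin t → ℕ} (σ : Fin (∑ u, n u) → Fin m) :
    invStat σ = ∑ u, ∑ v, letterCount (blockEquiv m t n σ u) v *
        ∑ i ∈ Finset.univ.filter (fun i => u < i),
          ∑ j ∈ Finset.univ.filter (fun j => j < v), letterCount (blockEquiv m t n σ i) j +
      ∑ u, invStat (blockEquiv m t n σ u) := by
  rw [invStat_eq_sum, ← Equiv.sum_comp finSigmaFinEquiv, Fintype.sum_sigma,
    ← Finset.sum_add_distrib]
  refine Finset.sum_congr rfl fun u _ => ?_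
  simp_rw [← Equiv.sum_comp (finSigmaFinEquiv (n := n)), Fintype.sum_sigma, Finset.mul_sum]
  have block (i : Fin t) : (∑ a, ∑ b,
      if (finSigmaFinEquiv ⟨u, a⟩ : Fin (∑ u, n u)) < finSigmaFinEquiv ⟨i, b⟩ ∧
        σ (finSigmaFinEquiv ⟨i, b⟩) < σ (finSigmaFinEquiv ⟨u, a⟩) then 1 else 0) =
      (if u < i then ∑ v, letterCount (blockEquiv m t n σ u) v *
        ∑ j ∈ Finset.univ.filter (fun j => j < v), letterCount (blockEquiv m t n σ i) j else 0) +
      if u = i then invStat (blockEquiv m t n σ u) else 0 := by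
    rcases lt_trichotomy u i with h | rfl | h
    · rw [← card_cross_inversions]
      simp [-Finset.sum_boole, h, h.ne, finSigmaFinEquiv_lt_of_fst_lt h, blockEquiv_apply]
      rfl
    · simp [-Finset.sum_boole, invStat_eq_sum, finSigmaFinEquiv_lt_iff_of_fst_eq, blockEquiv_apply]
      rfl
    · simp [h.not_gt, h.ne', (finSigmaFinEquiv_lt_of_fst_lt h _ _).not_gt]
  rw [Finset.sum_comm]
  simp_rw [block]
  rw [Finset.sum_add_distrib, ← Finset.sum_filter, Finset.sum_ite_eq, if_pos (Finset.mem_univ u),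
    Finset.sum_comm]
  simp_rw [Finset.mul_sum]

theorem qMultinomial_eq_sum_letterCount {n m : ℕ} (k : Fin m → ℕ) :
    qMultinomial n m k = ∑ σ ∈ Finset.univ.filter (fun σ : Fin n → Fin m => letterCount σ = k),
      X ^ invStat σ := by
  simp only [qMultinomial, funext_iff, letterCount]

/-- the generalized `q`-Vandermonde identity.
`[n_1+⋯+n_t; k_1, …, k_m]_q = Σ_{(r_{u,v})} q^{Σ_u Σ_{v≥2} f(r_{u,v})}
  ∏_u [n_u; r_{u,1}, …, r_{u,m}]_q`, summed over all arrays of nonnegative integers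
with row sums `n_u` and column sums `k_v`, where
`f(r_{u,v}) = r_{u,v} Σ_{i>u} Σ_{j<v} r_{i,j}`. -/
theorem stmt11 (m t : ℕ) (n : Fin t → ℕ) (k : Fin m → ℕ) (hk : ∑ v, k v = ∑ u, n u) :
    qMultinomial (∑ u, n u) m k =
      ∑ r ∈ (Fintype.piFinset fun u => Fintype.piFinset fun _ : Fin m =>
              Finset.Iic (n u)).filter
          (fun r : Fin t → Fin m → ℕ =>
            (∀ u, ∑ v, r u v = n u) ∧ (∀ v, ∑ u, r u v = k v)),
        X ^ (∑ u : Fin t, ∑ v ∈ Finset.univ.filter (fun v : Fin m => 0 < (v : ℕ)),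
              r u v * ∑ i ∈ Finset.univ.filter (fun i => u < i),
                ∑ j ∈ Finset.univ.filter (fun j => j < v), r i j) *
          ∏ u : Fin t, qMultinomial (n u) m (r u) := by
  rw [qMultinomial_eq_sum_letterCount]
  have crossings (r : Fin t → Fin m → ℕ) (u : Fin t) :
      ∑ v ∈ Finset.univ.filter (fun v : Fin m => 0 < (v : ℕ)),
        r u v * ∑ i ∈ Finset.univ.filter (fun i => u < i),
          ∑ j ∈ Finset.univ.filter (fun j => j < v), r i j =
      ∑ v, r u v * ∑ i ∈ Finset.univ.filter (fun i => u < i),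
          ∑ j ∈ Finset.univ.filter (fun j => j < v), r i j := by
    refine Finset.sum_subset (Finset.filter_subset _ _) fun v _ hv => ?_
    have hv0 : (v : ℕ) = 0 := by simpa using hv
    have hempty : Finset.univ.filter (fun j : Fin m => j < v) = ∅ := by
      ext j
      simp [Fin.lt_def, hv0]
    simp [hempty]
  simp_rw [qMultinomial_eq_sum_letterCount, crossings, Finset.prod_univ_sum]
  rw [Finset.sum_congr rfl fun r _ => Finset.mul_sum _ _ _, Finset.sum_sigma']
  refine Finset.sum_bij'
    (fun σ _ => ⟨fun u => letterCount (blockEquiv m t n σ u), blockEquiv m t n σ⟩)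
    (fun p _ => (blockEquiv m t n).symm p.2) ?_ ?_ ?_ ?_ ?_
  · intro σ hσ
    simp only [Finset.mem_filter, Finset.mem_univ, true_and] at hσ
    simp [← hσ, letterCount_le, sum_letterCount, letterCount_eq_sum_blocks]
  · rintro ⟨r, τ⟩ hp
    simp only [Finset.mem_sigma, Finset.mem_filter, Fintype.mem_piFinset, Finset.mem_univ,
      true_and] at hp ⊢
    obtain ⟨⟨-, -, hcol⟩, hτ⟩ := hp
    ext j
    simp [letterCount_eq_sum_blocks, hτ, hcol]
  · intro σ _
    simp
  · rintro ⟨r, τ⟩ hp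
    simp only [Finset.mem_sigma, Fintype.mem_piFinset, Finset.mem_filter, Finset.mem_univ,
      true_and] at hp
    obtain rfl : (fun u => letterCount (τ u)) = r := funext hp.2
    simp
  · intro σ _
    rw [invStat_eq_sum_blocks, pow_add, Finset.prod_pow_eq_pow_sum]
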